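/- Let A ∈ 𝒮(n), let Σ₀ ⊆ ℝⁿ be the direct sum of all eigenspaces of A corresponding to nonnegative eigenvalues, and let Π₀ be the orthogonal projection of ℝⁿ onto Σ₀. Then for every h ∈ ℝⁿ with Π₀h ≠ 0 and every δ > 0, |Ah + δ·Π₀h/|Π₀h||² ≥ |Ah|² + δ². -/

import Mathlib

open Metric Set MeasureTheory Topology

noncomputable section

abbrev En (n : ℕ) : Type := EuclideanSpace ℝ (Fin n)
abbrev Mat (n : ℕ) : Type := Matrix (Fin n) (Fin n) ℝ

/-- `F : 𝒮(n) → ℝ` is uniformly `(λ,Λ)`-elliptic: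
for all symmetric `A, B` with `B` positive semidefinite,
`λ·tr B ≤ F A − F (A + B) ≤ Λ·tr B`. -/
def UniformlyElliptic {n : ℕ} (lam Lam : ℝ) (F : Mat n → ℝ) : Prop :=
  Continuous F ∧
    ∀ A B : Mat n, A.IsSymm → B.IsSymm → B.PosSemidef →
      lam * B.trace ≤ F A - F (A + B) ∧ F A - F (A + B) ≤ Lam * B.trace

/-- The Hessian matrix of `φ` at `x`, in the standard basis of `ℝⁿ`. -/
def hessianMatrix {n : ℕ} (φ : En n → ℝ) (x : En n) : Mat n :=
  Matrix.of fun i j =>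
    iteratedFDeriv ℝ 2 φ x ![EuclideanSpace.single i (1 : ℝ), EuclideanSpace.single j (1 : ℝ)]

/-- `w` is a viscosity subsolution of `G(x, u(x), Du, D²u) = 0` on `Ω`:
whenever a `C²` function `φ` is such that `w − φ` has a local maximum (on `Ω`) at `x₀ ∈ Ω`,
then `G x₀ (w x₀) (Dφ x₀) (D²φ x₀) ≤ 0`. -/
def ViscSubOn {n : ℕ} (Ω : Set (En n)) (G : En n → ℝ → En n → Mat n → ℝ)
    (w : En n → ℝ) : Prop :=
  ∀ φ : En n → ℝ, ContDiff ℝ 2 φ → ∀ x₀ ∈ Ω,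
    IsLocalMaxOn (fun x => w x - φ x) Ω x₀ →
      G x₀ (w x₀) (gradient φ x₀) (hessianMatrix φ x₀) ≤ 0

/-- `w` is a viscosity supersolution of `G(x, u(x), Du, D²u) = 0` on `Ω`. -/
def ViscSupOn {n : ℕ} (Ω : Set (En n)) (G : En n → ℝ → En n → Mat n → ℝ)
    (w : En n → ℝ) : Prop :=
  ∀ φ : En n → ℝ, ContDiff ℝ 2 φ → ∀ x₀ ∈ Ω,
    IsLocalMinOn (fun x => w x - φ x) Ω x₀ →
      0 ≤ G x₀ (w x₀) (gradient φ x₀) (hessianMatrix φ x₀)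

/-- viscosity solution: both a subsolution and a supersolution. -/
def ViscSolOn {n : ℕ} (Ω : Set (En n)) (G : En n → ℝ → En n → Mat n → ℝ)
    (u : En n → ℝ) : Prop :=
  ViscSubOn Ω G u ∧ ViscSupOn Ω G u

/-- `H(x, z; ξ) = |ξ+z|^p + coef(x)·|ξ+z|^e`. -/
def Hfun {n : ℕ} (p e : ℝ) (coef : En n → ℝ) (ξ x z : En n) : ℝ :=
  ‖ξ + z‖ ^ p + coef x * ‖ξ + z‖ ^ e

/-- The switched exponent `p_v(x) = p⁺·1_{v>0}(x) + p⁻·1_{v<0}(x)`. -/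
def pSwitch {n : ℕ} (pp pm : ℝ) (v : En n → ℝ) (x : En n) : ℝ :=
  pp * Set.indicator {y | 0 < v y} (fun _ => (1 : ℝ)) x
    + pm * Set.indicator {y | v y < 0} (fun _ => (1 : ℝ)) x

/-- The transmission operator
`[|ξ+z|^{p_v(x)} + a(x)1_{v>0}|ξ+z|^q + b(x)1_{v<0}|ξ+z|^s]·F(X) − f(x)`. -/
def transOp {n : ℕ} (F : Mat n → ℝ) (pp pm q s : ℝ) (a b f v : En n → ℝ) (ξ : En n) :
    En n → ℝ → En n → Mat n → ℝ :=
  fun x _ z X =>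
    (‖ξ + z‖ ^ pSwitch pp pm v x
        + a x * Set.indicator {y | 0 < v y} (fun _ => (1 : ℝ)) x * ‖ξ + z‖ ^ q
        + b x * Set.indicator {y | v y < 0} (fun _ => (1 : ℝ)) x * ‖ξ + z‖ ^ s) * F X - f x

/-- `min{F(X), H_q(x,z;ξ)F(X), H_s(x,z;ξ)F(X)} − rhs(x)`. -/
def minOp {n : ℕ} (F : Mat n → ℝ) (pp pm q s : ℝ) (a b : En n → ℝ) (ξ : En n)
    (rhs : En n → ℝ) : En n → ℝ → En n → Mat n → ℝ :=
  fun x _ z X =>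
    min (F X) (min (Hfun pp q a ξ x z * F X) (Hfun pm s b ξ x z * F X)) - rhs x

/-- `max{F(X), H_q(x,z;ξ)F(X), H_s(x,z;ξ)F(X)} − rhs(x)`. -/
def maxOp {n : ℕ} (F : Mat n → ℝ) (pp pm q s : ℝ) (a b : En n → ℝ) (ξ : En n)
    (rhs : En n → ℝ) : En n → ℝ → En n → Mat n → ℝ :=
  fun x _ z X =>
    max (F X) (max (Hfun pp q a ξ x z * F X) (Hfun pm s b ξ x z * F X)) - rhs x

/-- Definition D: `u` is a viscosity solution of the free transmission equation
relative to the sign of `v`, with translation vector `ξ`. -/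
def DefDSolution {n : ℕ} (Ω : Set (En n)) (F : Mat n → ℝ) (pp pm q s : ℝ)
    (a b f : En n → ℝ) (v : En n → ℝ) (ξ : En n) (u : En n → ℝ) : Prop :=
  ViscSolOn ({x ∈ Ω | 0 < v x} ∪ {x ∈ Ω | v x < 0}) (transOp F pp pm q s a b f v ξ) u ∧
  ViscSubOn {x ∈ Ω | v x = 0} (minOp F pp pm q s a b ξ f) u ∧
  ViscSupOn {x ∈ Ω | v x = 0} (maxOp F pp pm q s a b ξ f) u

/-- Uniform exterior sphere condition for `Ω`. -/
def UnifExtSphere {n : ℕ} (Ω : Set (En n)) : Prop :=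
  ∃ r : ℝ, 0 < r ∧ ∀ y ∈ frontier Ω, ∃ x : En n,
    dist y x = r ∧ Metric.closedBall x r ∩ closure Ω = {y}

/-- `φ` is a smooth, nonnegative, radially symmetric mollifier supported in `B_ε(0)`
with unit mass. -/
def IsMollifier {n : ℕ} (ε : ℝ) (φ : En n → ℝ) : Prop :=
  ContDiff ℝ (⊤ : ℕ∞) φ ∧ (∀ x, 0 ≤ φ x) ∧ (∀ x y : En n, ‖x‖ = ‖y‖ → φ x = φ y) ∧
    (∫ x, φ x) = 1 ∧ ∀ x : En n, ε ≤ ‖x‖ → φ x = 0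

/-- The mollified indicator `(φε * 1_S)(x)`. -/
def smoothedChi {n : ℕ} (φε : En n → ℝ) (S : Set (En n)) (x : En n) : ℝ :=
  ∫ y, φε y * S.indicator (fun _ => (1 : ℝ)) (x - y)

/-- `ℓ_μ(z) = √(μ² + |z|²)`. -/
def ellReg {n : ℕ} (μ : ℝ) (z : En n) : ℝ := Real.sqrt (μ ^ 2 + ‖z‖ ^ 2)

/-- The regularized operator
`G_ε(x, z)·(ε·r + F(X)) − f(x)`, where
`G_ε(x,z) = ℓ_ε(z)^{p_{ε;v}(x)} + a_{ε;v}(x) ℓ_ε(z)^q + b_{ε;v}(x) ℓ_ε(z)^s`. -/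
def regOp {n : ℕ} (F : Mat n → ℝ) (ε pp pm q s : ℝ) (a b v f φε : En n → ℝ) :
    En n → ℝ → En n → Mat n → ℝ :=
  fun x r z X =>
    (ellReg ε z ^ (ε + pp * smoothedChi φε {y | 0 < v y} x + pm * smoothedChi φε {y | v y < 0} x)
        + (ε + a x * smoothedChi φε {y | 0 < v y} x) * ellReg ε z ^ q
        + (ε + b x * smoothedChi φε {y | v y < 0} x) * ellReg ε z ^ s) * (ε * r + F X) - f x

/-- The Multi-Phase operator with variable exponents:
`[ℓ_μ(z)^{p(x)} + a(x)ℓ_μ(z)^{q(x)} + b(x)ℓ_μ(z)^{s(x)}]·(μ·r + F(X)) − f(x)`. -/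
def mpOp {n : ℕ} (F : Mat n → ℝ) (μ : ℝ) (p q s a b f : En n → ℝ) :
    En n → ℝ → En n → Mat n → ℝ :=
  fun x r z X =>
    (ellReg μ z ^ p x + a x * ellReg μ z ^ q x + b x * ellReg μ z ^ s x) * (μ * r + F X) - f x

/-- Pucci maximal operator `M⁺_{λ,Λ}(A) = −Λ·tr(A⁻) − λ·tr(A⁺)`. -/
def pucciPlus {n : ℕ} (lam Lam : ℝ) (A : Mat n) : ℝ :=
  if h : A.IsHermitian then
    -(Lam * ∑ i, min (h.eigenvalues i) 0) - lam * ∑ i, max (h.eigenvalues i) 0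
  else 0

/-- Pucci minimal operator `M⁻_{λ,Λ}(A) = −Λ·tr(A⁺) − λ·tr(A⁻)`. -/
def pucciMinus {n : ℕ} (lam Lam : ℝ) (A : Mat n) : ℝ :=
  if h : A.IsHermitian then
    -(Lam * ∑ i, max (h.eigenvalues i) 0) - lam * ∑ i, min (h.eigenvalues i) 0
  else 0

/-- `u` is locally `β`-Hölder continuous on `Ω`. -/
def LocallyHolderOn {n : ℕ} (Ω : Set (En n)) (β : ℝ) (u : En n → ℝ) : Prop :=
  ∀ x ∈ Ω, ∃ ε > 0, ∃ C : ℝ, ∀ y ∈ ball x ε ∩ Ω, ∀ z ∈ ball x ε ∩ Ω,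
    |u y - u z| ≤ C * ‖y - z‖ ^ β

/-- `u ∈ C^{1,α}_loc(Ω)`: `u` is differentiable on `Ω` with locally
`α`-Hölder continuous gradient. -/
def C1HolderLocOn {n : ℕ} (Ω : Set (En n)) (α : ℝ) (u : En n → ℝ) : Prop :=
  (∀ x ∈ Ω, DifferentiableAt ℝ u x) ∧
  ∀ x ∈ Ω, ∃ ε > 0, ∃ C : ℝ, ∀ y ∈ ball x ε ∩ Ω, ∀ z ∈ ball x ε ∩ Ω,
    ‖gradient u y - gradient u z‖ ≤ C * ‖y - z‖ ^ α

theorem inner_nonneg_aux {n : ℕ} (T : En n →ₗ[ℝ] En n) (hT : T.IsSymmetric)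
    (p : En n) (hp : p ∈ ⨆ (μ : {μ : ℝ // 0 ≤ μ}), Module.End.eigenspace T μ.1) :
    0 ≤ inner ℝ p (T p) := by
  obtain ⟨f, hf, rfl⟩ := (Submodule.mem_iSup_iff_exists_finsupp _ _).1 hp
  simp only [Finsupp.sum, map_sum, sum_inner, inner_sum]
  refine Finset.sum_nonneg fun i _ => Finset.sum_nonneg fun j _ => ?_
  have hi := hf i
  have hj := hf j
  rw [Module.End.mem_eigenspace_iff.1 (by assumption), real_inner_smul_right]
  by_cases hij : i = j
  · subst hij
    exact mul_nonneg i.2 real_inner_self_nonneg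
  · have h0 : inner ℝ (f i) (f j) = 0 := by
      exact hT.orthogonalFamily_eigenspaces (fun e => hij (Subtype.ext e)) ⟨f i, hi⟩ ⟨f j, hj⟩
    rw [real_inner_comm, h0, mul_zero]

/-- for a symmetric matrix `A`, with `Π₀` the orthogonal projection onto
the direct sum `S₀` of the eigenspaces of `A` with nonnegative eigenvalues,
`|Ah + δ·Π₀h/|Π₀h||² ≥ |Ah|² + δ²` whenever `Π₀h ≠ 0` and `δ > 0`. -/
theorem projection_eigenspace_inequality
    {n : ℕ} (A : Mat n) (hA : A.IsSymm)
    (S₀ : Submodule ℝ (En n))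
    (hS₀ : S₀ = ⨆ (μ : ℝ) (_ : 0 ≤ μ), Module.End.eigenspace (Matrix.toEuclideanLin A) μ)
    (h : En n) (hh : (Submodule.orthogonalProjection S₀ h : En n) ≠ 0) (δ : ℝ) (hδ : 0 < δ) :
    ‖Matrix.toEuclideanLin A h‖ ^ 2 + δ ^ 2 ≤
      ‖Matrix.toEuclideanLin A h +
        (δ / ‖(Submodule.orthogonalProjection S₀ h : En n)‖) • (Submodule.orthogonalProjection S₀ h : En n)‖ ^ 2 := by
  have hT : (Matrix.toEuclideanLin A).IsSymmetric :=
    Matrix.isSymmetric_toEuclideanLin_iff.2 (by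
      rw [Matrix.IsHermitian, Matrix.conjTranspose_eq_transpose_of_trivial]; exact hA)
  generalize Matrix.toEuclideanLin A = T at *
  rw [iSup_subtype'] at hS₀
  have hpS : (Submodule.orthogonalProjection S₀ h : En n) ∈ S₀ := Subtype.mem _
  have horth : ∀ w ∈ S₀, inner ℝ (h - (Submodule.orthogonalProjection S₀ h : En n)) w = 0 :=
    fun w hw => Submodule.starProjection_inner_eq_zero h w hw
  generalize (Submodule.orthogonalProjection S₀ h : En n) = p at *
  have hinv : ∀ w ∈ S₀, T w ∈ S₀ := by
    intro w hw
    rw [hS₀] at hw ⊢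
    refine Submodule.iSup_induction _ (motive := fun w => T w ∈ _) hw ?_ (by simp) ?_
    · intro i x hx
      rw [Module.End.mem_eigenspace_iff.1 hx]
      exact Submodule.smul_mem _ _ (Submodule.mem_iSup_of_mem i hx)
    · intro x y hx hy
      rw [map_add]
      exact Submodule.add_mem _ hx hy
  have h1 : 0 ≤ inner ℝ p (T p) := inner_nonneg_aux T hT p (hS₀ ▸ hpS)
  have h2 := horth (T p) (hinv p hpS)
  rw [inner_sub_left] at h2
  have h3 : 0 ≤ inner ℝ (T h) p := by
    rw [hT h p]; linarith
  have hn : 0 < ‖p‖ := norm_pos_iff.2 hh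
  rw [norm_add_sq_real, real_inner_smul_right, norm_smul, Real.norm_of_nonneg (by positivity),
    div_mul_cancel₀ _ hn.ne']
  have h4 : 0 ≤ δ / ‖p‖ * inner ℝ (T h) p := by positivity
  linarith
end
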